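/- arXiv:1405.3232 — 2 statements merged into one kernel-verified Lean document; each statement's English description precedes it below -/
import Mathlib

section
/- Let L' be an even unimodular lattice and let L ⊆ L' be a primitive nondegenerate sublattice. Let g ∈ O(L) be an isometry acting trivially on the discriminant group A_L. Then there exists an isometry ḡ ∈ O(L') such that the restriction of ḡ to L equals g and the restriction of ḡ to the orthogonal complement L^⊥ in L' is the identity. -/
open Module

/-- an isometry of a primitive nondegenerate sublattice `L` of an even
unimodular lattice `L'` acting trivially on the discriminant group `A_L` extends to
an isometry of `L'` which is the identity on `L^⊥`.

Here the discriminant group `A_L = L^∨/L` is identified (via the nondegenerate form)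
with the cokernel of `L → Hom(L, ℤ), z ↦ b(z, ·)`; triviality of the action of `g`
is expressed by `hdisc`. -/
theorem stmt1 {L' : Type*} [AddCommGroup L'] [Module.Free ℤ L'] [Module.Finite ℤ L']
    (b : L' →ₗ[ℤ] L' →ₗ[ℤ] ℤ)
    (hsymm : ∀ x y : L', b x y = b y x)
    (heven : ∀ x : L', Even (b x x))
    (hunimodular : Function.Bijective b)
    (L : Submodule ℤ L')
    (hprim : ∀ (x : L') (k : ℤ), k ≠ 0 → k • x ∈ L → x ∈ L)
    (hnondeg : ∀ x ∈ L, (∀ y ∈ L, b x y = 0) → x = 0)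
    (g : L ≃ₗ[ℤ] L)
    (hgiso : ∀ x y : L, b (g x : L') (g y : L') = b (x : L') (y : L'))
    (hdisc : ∀ φ : L →ₗ[ℤ] ℤ, ∃ z : L, ∀ x : L, φ (g x) = φ x + b (z : L') (x : L')) :
    ∃ gbar : L' ≃ₗ[ℤ] L',
      (∀ x y : L', b (gbar x) (gbar y) = b x y) ∧
      (∀ x : L, gbar (x : L') = (g x : L')) ∧
      (∀ x : L', (∀ y ∈ L, b x y = 0) → gbar x = x) := by
  have hnd : ∀ x : L, (∀ y : L, b (x : L') (y : L') = 0) → x = 0 := by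
    intro x h
    exact Subtype.ext (hnondeg x x.2 (fun y hy => h ⟨y, hy⟩))
  have hdec : ∀ v : L', ∃ n : ℤ, n ≠ 0 ∧ ∃ p : L, ∃ q : L',
      (∀ y : L, b q (y : L') = 0) ∧ n • v = (p : L') + q := by
    intro v
    let B : L →ₗ[ℤ] (L →ₗ[ℤ] ℤ) := (LinearMap.lcomp ℤ ℤ L.subtype).comp (b.comp L.subtype)
    have hB : ∀ x y : L, B x y = b (x : L') (y : L') := fun x y => rfl
    have hBinj : Function.Injective B := by
      rw [injective_iff_map_eq_zero]
      intro x hx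
      apply hnd
      intro y
      rw [← hB, hx]; rfl
    have hr : Module.finrank ℤ (LinearMap.range B) = Module.finrank ℤ (L →ₗ[ℤ] ℤ) := by
      rw [LinearMap.finrank_range_of_inj hBinj, Module.finrank_linearMap_self]
    haveI : Finite ((L →ₗ[ℤ] ℤ) ⧸ LinearMap.range B) :=
      Submodule.finiteQuotientOfFreeOfRankEq _ hr
    let φ : L →ₗ[ℤ] ℤ := (b v).comp L.subtype
    have h0 : (Nat.card ((L →ₗ[ℤ] ℤ) ⧸ LinearMap.range B)) •
        (Submodule.Quotient.mk φ : (L →ₗ[ℤ] ℤ) ⧸ LinearMap.range B) = 0 := card_nsmul_eq_zero'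
    have hc : Nat.card ((L →ₗ[ℤ] ℤ) ⧸ LinearMap.range B) ≠ 0 := Nat.card_pos.ne'
    generalize Nat.card ((L →ₗ[ℤ] ℤ) ⧸ LinearMap.range B) = n at h0 hc
    rw [← Submodule.Quotient.mk_smul, Submodule.Quotient.mk_eq_zero] at h0
    obtain ⟨p, hp⟩ := h0
    refine ⟨n, by exact_mod_cast hc, p, (n : ℤ) • v - p, ?_, by abel⟩
    intro y
    have h1 := congrArg (fun f : L →ₗ[ℤ] ℤ => f y) hp
    have h2 : b (p : L') (y : L') = (n : ℤ) * b v (y : L') := by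
      simpa [φ, hB] using h1
    simp [h2]
  have hex : ∀ x : L', ∃ z : L, ∀ y : L,
      b (z : L') (g y : L') = b x (y : L') - b x (g y : L') := by
    intro x
    obtain ⟨w, hw⟩ := hdisc ((b x).comp L.subtype)
    refine ⟨- g w, fun y => ?_⟩
    have h1 : b x (g y : L') = b x (y : L') + b (w : L') (y : L') := hw y
    have h2 := hgiso w y
    simp only [Submodule.coe_neg, map_neg, LinearMap.neg_apply]
    linarith
  choose z hz using hex
  have huniq : ∀ (x : L') (w : L), (∀ y : L,
      b (w : L') (g y : L') = b x (y : L') - b x (g y : L')) → z x = w := by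
    intro x w h
    rw [← sub_eq_zero]
    apply hnd
    intro y
    have h1 := h (g.symm y)
    have h2 := hz x (g.symm y)
    rw [g.apply_symm_apply] at h1 h2
    simp only [Submodule.coe_sub, map_sub, LinearMap.sub_apply]
    linarith
  let G : L' →ₗ[ℤ] L' := 
    { toFun := fun x => x + z x
      map_add' := by
        intro x x'
        rw [huniq (x + x') (z x + z x') (fun y => by
          simp only [Submodule.coe_add, map_add, LinearMap.add_apply, hz]; ring)]
        simp only [Submodule.coe_add]; abel
      map_smul' := by
        intro c x
        rw [huniq (c • x) (c • z x) (fun y => by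
          simp only [Submodule.coe_smul, map_smul, LinearMap.smul_apply, hz, smul_eq_mul]; ring)]
        simp }
  have hG : ∀ x, G x = x + z x := fun x => rfl
  have hGL : ∀ x : L, G (x : L') = (g x : L') := by
    intro x
    rw [hG, huniq x (g x - x) (fun y => by
      simp only [Submodule.coe_sub, map_sub, LinearMap.sub_apply, hgiso])]
    simp
  have hGP : ∀ x : L', (∀ y : L, b x (y : L') = 0) → G x = x := by
    intro x h
    rw [hG, huniq x 0 (fun y => by simp [h])]
    simp
  have hGb : ∀ (x : L') (y : L), b (G x) (g y : L') = b x (y : L') := by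
    intro x y
    rw [hG, map_add, LinearMap.add_apply, hz]; ring
  have hGq : ∀ (x q : L'), (∀ y : L, b q (y : L') = 0) → b (G x) q = b x q := by
    intro x q h
    rw [hG, map_add, LinearMap.add_apply, hsymm (z x : L') q, h, add_zero]
  have hiso : ∀ x y : L', b (G x) (G y) = b x y := by
    intro x y
    obtain ⟨n, hn, p, q, hq, h⟩ := hdec y
    apply mul_left_cancel₀ hn
    have h1 : n * b (G x) (G y) = b (G x) (G (n • y)) := by simp
    have h2 : n * b x y = b x (n • y) := by simp
    rw [h1, h2, h, map_add G, hGL, hGP q hq, map_add, map_add, hGb, hGq x q hq]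
  have hbij : Function.Bijective G := by
    constructor
    · rw [injective_iff_map_eq_zero]
      intro x hx
      apply hunimodular.1
      ext y
      rw [← hiso, hx]; simp
    · intro y
      obtain ⟨x, hx⟩ := hunimodular.2 ((b y).comp G)
      refine ⟨x, ?_⟩
      apply hunimodular.1
      ext v
      obtain ⟨n, hn, p, q, hq, h⟩ := hdec v
      apply mul_left_cancel₀ hn
      have h3 : n • v = G ((g.symm p : L) + q) := by
        rw [map_add, hGL, hGP q hq, g.apply_symm_apply, h]
      have h1 : ∀ u, n * b u v = b u (n • v) := by intro u; simp
      rw [h1, h1, h3, hiso, hx]; rfl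
  exact ⟨LinearEquiv.ofBijective G hbij, hiso, hGL, fun x h => hGP x (fun y => h y y.2)⟩
end

section
/- Let n ≥ 2 with n ≡ 1 (mod 3), let v ∈ L_M be a primitive vector with b(v,v) = 2n−2, and suppose the lattice S_{3.exo} is primitively embedded into v^⊥ ⊆ L_M. Then there exists an element t in the image of S_{3.exo} such that (v+t)/3 ∈ L_M and t is a numerical wall divisor with respect to v. -/
open Matrix Module

/-- The bilinear form on `ι → ℤ` associated to a Gram matrix. -/
def gramBilin {ι : Type*} [Fintype ι] (G : Matrix ι ι ℤ) :
    (ι → ℤ) →ₗ[ℤ] (ι → ℤ) →ₗ[ℤ] ℤ :=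
  LinearMap.mk₂ ℤ (fun x y => x ⬝ᵥ (G *ᵥ y))
    (fun x x' y => add_dotProduct x x' (G *ᵥ y))
    (fun c x y => smul_dotProduct c x (G *ᵥ y))
    (fun x y y' => by show x ⬝ᵥ (G *ᵥ (y + y')) = _; rw [Matrix.mulVec_add, dotProduct_add])
    (fun c x y => by show x ⬝ᵥ (G *ᵥ (c • y)) = _; rw [Matrix.mulVec_smul, dotProduct_smul])

/-- The E8 Cartan matrix (Bourbaki numbering). -/
def E8M : Matrix (Fin 8) (Fin 8) ℤ :=
  !![2,0,-1,0,0,0,0,0;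
     0,2,0,-1,0,0,0,0;
     -1,0,2,-1,0,0,0,0;
     0,-1,-1,2,-1,0,0,0;
     0,0,0,-1,2,-1,0,0;
     0,0,0,0,-1,2,-1,0;
     0,0,0,0,0,-1,2,-1;
     0,0,0,0,0,0,-1,2]

/-- Index type for the Mukai lattice `L_M = U^4 ⊕ E8(-1)^2`. -/
abbrev MukaiIx : Type := (Fin 4 × Fin 2) ⊕ (Fin 2 × Fin 8)

/-- The underlying module of the Mukai lattice. -/
abbrev LM : Type := MukaiIx → ℤ

/-- The Gram matrix of the Mukai lattice `U^4 ⊕ E8(-1)^2`. -/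
def GLM : Matrix MukaiIx MukaiIx ℤ :=
  Matrix.of fun p q =>
    match p, q with
    | .inl (i, a), .inl (j, b) => if i = j ∧ a ≠ b then 1 else 0
    | .inr (i, a), .inr (j, b) => if i = j then -(E8M a b) else 0
    | _, _ => 0

/-- The bilinear form of the Mukai lattice. -/
def bLM : LM →ₗ[ℤ] LM →ₗ[ℤ] ℤ := gramBilin GLM

/-- `D` is a numerical wall divisor with respect to a primitive `v ∈ L_M`. -/
def IsWallDivisor (v D : LM) : Prop :=
  bLM v D = 0 ∧ D ≠ 0 ∧
  (∀ (k : ℤ) (w : LM), bLM v w = 0 → D = k • w → IsUnit k) ∧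
  ∃ (T : Submodule ℤ LM) (r : LM),
    v ∈ T ∧ D ∈ T ∧ Module.finrank ℤ T = 2 ∧
    (∀ (x : LM) (k : ℤ), k ≠ 0 → k • x ∈ T → x ∈ T) ∧
    T = Submodule.span ℤ {v, r} ∧
    ((bLM r r = -2 ∧ 0 ≤ bLM v r ∧ 2 * bLM v r ≤ bLM v v) ∨
     (0 ≤ bLM r r * bLM v v ∧ bLM r r * bLM v v ≤ (bLM v r) ^ 2 ∧
       4 * (bLM v r) ^ 2 < (bLM v v) ^ 2))

/-- The underlying module of `E8(-1)^3`. -/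
abbrev E83 : Type := Fin 3 → Fin 8 → ℤ

/-- The bilinear form of `E8(-1)^3`. -/
def bE83 (x y : E83) : ℤ := -∑ j : Fin 3, (x j) ⬝ᵥ (E8M *ᵥ (y j))

/-- The cyclic permutation `σ(x, y, z) = (z, x, y)` of the three factors of
`E8(-1)^3`. -/
def sigma3 : E83 ≃ₗ[ℤ] E83 where
  toFun x := fun j => x (j - 1)
  invFun x := fun j => x (j + 1)
  map_add' := fun _ _ => rfl
  map_smul' := fun _ _ => rfl
  left_inv := by intro x; funext j; simp
  right_inv := by intro x; funext j; simp

/-- The lattice `S_{3.exo} = {a - σ(a) : a ∈ E8(-1)^3}`. -/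
def S3exo : Submodule ℤ E83 :=
  LinearMap.range (LinearMap.id - sigma3.toLinearMap)

abbrev EE : (Fin 8 → ℤ) →ₗ[ℤ] (Fin 8 → ℤ) →ₗ[ℤ] ℤ := gramBilin E8M

lemma EE_apply (x y : Fin 8 → ℤ) : EE x y = x ⬝ᵥ (E8M *ᵥ y) := rfl

lemma EE_expand (x y : Fin 8 → ℤ) : EE x y =
    x 0 * (2 * y 0 - y 2) + x 1 * (2 * y 1 - y 3) + x 2 * (2 * y 2 - y 0 - y 3)
    + x 3 * (2 * y 3 - y 1 - y 2 - y 4) + x 4 * (2 * y 4 - y 3 - y 5)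
    + x 5 * (2 * y 5 - y 4 - y 6) + x 6 * (2 * y 6 - y 5 - y 7) + x 7 * (2 * y 7 - y 6) := by
  rw [EE_apply]
  simp [E8M, dotProduct, Matrix.mulVec, Fin.sum_univ_eight]
  ring

lemma EE_symm (x y : Fin 8 → ℤ) : EE x y = EE y x := by
  rw [EE_expand, EE_expand]; ring

lemma EE_nonneg (x : Fin 8 → ℤ) : 0 ≤ EE x x := by
  rw [EE_expand]
  nlinarith [sq_nonneg (2 * x 0 - x 2), sq_nonneg (2 * x 1 - x 3), sq_nonneg (3 * x 2 - 2 * x 3),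
    sq_nonneg (5 * x 3 - 6 * x 4), sq_nonneg (4 * x 4 - 5 * x 5), sq_nonneg (3 * x 5 - 4 * x 6),
    sq_nonneg (2 * x 6 - 3 * x 7), sq_nonneg (x 7)]

/-- Every class mod 3 of E8 has a good representative. -/
def GoodC (c : Fin 8 → ℤ) : Prop :=
  (∃ u, c = (3 : ℤ) • u) ∨ ∃ p m u y : Fin 8 → ℤ, p = c + (3 : ℤ) • u ∧ EE p y = 1 ∧
    (EE p p + 3 * EE p m + 3 * EE m m = 2 ∨ EE p p + 3 * EE p m + 3 * EE m m = 4 ∨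
     EE p p + 3 * EE p m + 3 * EE m m = 5 ∨ EE p p + 3 * EE p m + 3 * EE m m = 6)

lemma GoodC_shift (c d : Fin 8 → ℤ) (h : GoodC (c + (3 : ℤ) • d)) : GoodC c := by
  rcases h with ⟨u, hu⟩ | ⟨p, m, u, y, hp, h⟩
  · left; exact ⟨u - d, by rw [smul_sub, ← hu]; abel⟩
  · right; exact ⟨p, m, u + d, y, by rw [hp, smul_add]; abel, h⟩

def refl8 (a x : Fin 8 → ℤ) : Fin 8 → ℤ := x - (EE x a) • a

lemma refl8_EE (a x y : Fin 8 → ℤ) (ha : EE a a = 2) : EE (refl8 a x) (refl8 a y) = EE x y := by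
  simp only [refl8, map_sub, map_smul, LinearMap.sub_apply, LinearMap.smul_apply, smul_eq_mul, ha]
  rw [EE_symm a y]; ring

lemma refl8_refl8 (a x : Fin 8 → ℤ) (ha : EE a a = 2) : refl8 a (refl8 a x) = x := by
  simp only [refl8, map_sub, map_smul, LinearMap.sub_apply, LinearMap.smul_apply, smul_eq_mul, ha]
  module

lemma refl8_add (a x y : Fin 8 → ℤ) (k : ℤ) : refl8 a (x + k • y) = refl8 a x + k • refl8 a y := by
  simp only [refl8, map_add, map_smul, LinearMap.add_apply, LinearMap.smul_apply, smul_eq_mul]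
  module

lemma GoodC_refl (a c : Fin 8 → ℤ) (ha : EE a a = 2) (h : GoodC (refl8 a c)) : GoodC c := by
  rcases h with ⟨u, hu⟩ | ⟨p, m, u, y, hp, h1, h⟩
  · left; refine ⟨refl8 a u, ?_⟩
    have := congrArg (refl8 a) hu
    rw [refl8_refl8 a c ha] at this
    rw [this]
    simp only [refl8, map_smul, LinearMap.smul_apply, smul_eq_mul]; module
  · right; refine ⟨refl8 a p, refl8 a m, refl8 a u, refl8 a y, ?_, ?_, ?_⟩
    · rw [hp, refl8_add, refl8_refl8 a c ha]
    · rw [refl8_EE _ _ _ ha]; exact h1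
    · simp only [refl8_EE _ _ _ ha]; exact h

def theta8 : Fin 8 → ℤ := ![2,3,4,6,5,4,3,2]
def rho8 : Fin 8 → ℤ := ![46,68,91,135,110,84,57,29]

def meas8 (p : Fin 8 → ℤ) : ℤ := 10 * EE p p - 2 * ∑ i, p i

lemma meas8_bound (p : Fin 8 → ℤ) : 0 ≤ meas8 p + 62 := by
  have h := EE_nonneg ((10 : ℤ) • p - rho8)
  have h2 : EE p rho8 = ∑ i, p i := by
    rw [EE_expand]; simp [rho8, Fin.sum_univ_eight]
  have h3 : EE rho8 rho8 = 620 := by rw [EE_expand]; simp [rho8]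
  simp only [map_sub, map_smul, LinearMap.sub_apply, LinearMap.smul_apply, smul_eq_mul, h3, h2,
    EE_symm rho8 p] at h
  unfold meas8; linarith

lemma simple_root (i : Fin 8) : EE (Pi.single i 1) (Pi.single i 1) = 2 := by
  rw [EE_expand]; fin_cases i <;> simp

lemma theta_root : EE theta8 theta8 = 2 := by rw [EE_expand]; simp [theta8]

lemma meas8_refl (i : Fin 8) (p : Fin 8 → ℤ) :
    meas8 (refl8 (Pi.single i 1) p) = meas8 p + 2 * EE p (Pi.single i 1) := by
  unfold meas8
  rw [refl8_EE _ _ _ (simple_root i)]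
  simp only [refl8, Pi.sub_apply, Pi.smul_apply, Finset.sum_sub_distrib, smul_eq_mul,
    ← Finset.mul_sum, Finset.sum_pi_single', Finset.mem_univ, if_true]
  ring

lemma meas8_theta (p : Fin 8 → ℤ) :
    meas8 (refl8 theta8 p + (3 : ℤ) • theta8) = meas8 p - 2 * (EE p theta8 - 3) := by
  unfold meas8
  have hs : ∑ i, theta8 i = 29 := by simp [theta8, Fin.sum_univ_eight]
  have : refl8 theta8 p + (3 : ℤ) • theta8 = p - (EE p theta8 - 3) • theta8 := by
    unfold refl8; module
  rw [this]
  simp only [map_sub, map_smul, LinearMap.sub_apply, LinearMap.smul_apply, smul_eq_mul,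
    theta_root, EE_symm theta8 p, Pi.sub_apply, Pi.smul_apply, Finset.sum_sub_distrib,
    ← Finset.mul_sum, hs]
  ring

lemma term_aux (x0 x1 x2 x3 x4 x5 x6 x7 : ℤ) (h0 : 0 ≤ 2 * x0 - x2) (h1 : 0 ≤ 2 * x1 - x3)
    (h2 : 0 ≤ 2 * x2 - x0 - x3) (h3 : 0 ≤ 2 * x3 - x1 - x2 - x4) (h4 : 0 ≤ 2 * x4 - x3 - x5)
    (h5 : 0 ≤ 2 * x5 - x4 - x6) (h6 : 0 ≤ 2 * x6 - x5 - x7) (h7 : 0 ≤ 2 * x7 - x6)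
    (ht : x7 ≤ 3) :
    (x0 = 0 ∧ x1 = 0 ∧ x2 = 0 ∧ x3 = 0 ∧ x4 = 0 ∧ x5 = 0 ∧ x6 = 0 ∧ x7 = 0) ∨
    (x0 = 4 ∧ x1 = 5 ∧ x2 = 7 ∧ x3 = 10 ∧ x4 = 8 ∧ x5 = 6 ∧ x6 = 4 ∧ x7 = 2) ∨
    (x0 = 2 ∧ x1 = 3 ∧ x2 = 4 ∧ x3 = 6 ∧ x4 = 5 ∧ x5 = 4 ∧ x6 = 3 ∧ x7 = 2) ∨
    (x0 = 5 ∧ x1 = 8 ∧ x2 = 10 ∧ x3 = 15 ∧ x4 = 12 ∧ x5 = 9 ∧ x6 = 6 ∧ x7 = 3) ∨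
    (x0 = 4 ∧ x1 = 6 ∧ x2 = 8 ∧ x3 = 12 ∧ x4 = 10 ∧ x5 = 8 ∧ x6 = 6 ∧ x7 = 3) := by
  obtain ⟨c0, e0⟩ : ∃ c, c = 2 * x0 - x2 := ⟨_, rfl⟩
  obtain ⟨c1, e1⟩ : ∃ c, c = 2 * x1 - x3 := ⟨_, rfl⟩
  obtain ⟨c2, e2⟩ : ∃ c, c = 2 * x2 - x0 - x3 := ⟨_, rfl⟩
  obtain ⟨c3, e3⟩ : ∃ c, c = 2 * x3 - x1 - x2 - x4 := ⟨_, rfl⟩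
  obtain ⟨c4, e4⟩ : ∃ c, c = 2 * x4 - x3 - x5 := ⟨_, rfl⟩
  obtain ⟨c5, e5⟩ : ∃ c, c = 2 * x5 - x4 - x6 := ⟨_, rfl⟩
  obtain ⟨c6, e6⟩ : ∃ c, c = 2 * x6 - x5 - x7 := ⟨_, rfl⟩
  obtain ⟨c7, e7⟩ : ∃ c, c = 2 * x7 - x6 := ⟨_, rfl⟩
  rw [← e0] at h0
  rw [← e1] at h1
  rw [← e2] at h2
  rw [← e3] at h3
  rw [← e4] at h4
  rw [← e5] at h5
  rw [← e6] at h6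
  rw [← e7] at h7
  have b : 2 * c0 + 3 * c1 + 4 * c2 + 6 * c3 + 5 * c4 + 4 * c5 + 3 * c6 + 2 * c7 ≤ 3 := by
    linarith
  have : c2 = 0 ∧ c3 = 0 ∧ c4 = 0 ∧ c5 = 0 ∧
      ((c0 = 0 ∧ c1 = 0 ∧ c6 = 0 ∧ c7 = 0) ∨ (c0 = 1 ∧ c1 = 0 ∧ c6 = 0 ∧ c7 = 0) ∨
      (c0 = 0 ∧ c1 = 1 ∧ c6 = 0 ∧ c7 = 0) ∨ (c0 = 0 ∧ c1 = 0 ∧ c6 = 1 ∧ c7 = 0) ∨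
      (c0 = 0 ∧ c1 = 0 ∧ c6 = 0 ∧ c7 = 1)) := by
    clear e0 e1 e2 e3 e4 e5 e6 e7 ht
    omega
  obtain ⟨r2, r3, r4, r5, this⟩ := this
  rcases this with ⟨r0, r1, r6, r7⟩ | ⟨r0, r1, r6, r7⟩ | ⟨r0, r1, r6, r7⟩ | ⟨r0, r1, r6, r7⟩ |
    ⟨r0, r1, r6, r7⟩
  · left; refine ⟨?_, ?_, ?_, ?_, ?_, ?_, ?_, ?_⟩ <;> linarith
  · right; left; refine ⟨?_, ?_, ?_, ?_, ?_, ?_, ?_, ?_⟩ <;> linarith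
  · right; right; right; left; refine ⟨?_, ?_, ?_, ?_, ?_, ?_, ?_, ?_⟩ <;> linarith
  · right; right; right; right; refine ⟨?_, ?_, ?_, ?_, ?_, ?_, ?_, ?_⟩ <;> linarith
  · right; right; left; refine ⟨?_, ?_, ?_, ?_, ?_, ?_, ?_, ?_⟩ <;> linarith

lemma GoodC_terminal (p : Fin 8 → ℤ) (h : ∀ i, 0 ≤ EE p (Pi.single i 1))
    (ht : EE p theta8 ≤ 3) : GoodC p := by
  have h0 := h 0
  have h1 := h 1
  have h2 := h 2
  have h3 := h 3
  have h4 := h 4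
  have h5 := h 5
  have h6 := h 6
  have h7 := h 7
  simp only [EE_expand, Pi.single_apply, theta8] at h0 h1 h2 h3 h4 h5 h6 h7 ht
  simp at h0 h1 h2 h3 h4 h5 h6 h7 ht
  have key : p = ![0,0,0,0,0,0,0,0] ∨ p = ![4,5,7,10,8,6,4,2] ∨ p = ![2,3,4,6,5,4,3,2] ∨
      p = ![5,8,10,15,12,9,6,3] ∨ p = ![4,6,8,12,10,8,6,3] := by
    have e : ∀ a0 a1 a2 a3 a4 a5 a6 a7 : ℤ, p = ![a0,a1,a2,a3,a4,a5,a6,a7] ↔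
        (p 0 = a0 ∧ p 1 = a1 ∧ p 2 = a2 ∧ p 3 = a3 ∧ p 4 = a4 ∧ p 5 = a5 ∧ p 6 = a6 ∧ p 7 = a7) := by
      intros; constructor
      · rintro rfl; simp
      · rintro ⟨q0,q1,q2,q3,q4,q5,q6,q7⟩
        funext i; fin_cases i <;> simp [*]
    simp only [e]
    generalize p 0 = x0 at *
    generalize p 1 = x1 at *
    generalize p 2 = x2 at *
    generalize p 3 = x3 at *
    generalize p 4 = x4 at *
    generalize p 5 = x5 at *
    generalize p 6 = x6 at *
    generalize p 7 = x7 at *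
    clear e h
    exact term_aux x0 x1 x2 x3 x4 x5 x6 x7 (by linarith) (by linarith) (by linarith) (by linarith)
      (by linarith) (by linarith) (by linarith) (by linarith) (by linarith)
  clear h h0 h1 h2 h3 h4 h5 h6 h7 ht
  rcases key with rfl | rfl | rfl | rfl | rfl
  · left; exact ⟨0, by simp⟩
  · right; refine ⟨_, 0, 0, Pi.single 0 1, by simp; rfl, ?_, ?_⟩ <;> simp only [EE_expand] <;> decide
  · right; refine ⟨_, 0, 0, Pi.single 7 1, by simp; rfl, ?_, ?_⟩ <;> simp only [EE_expand] <;> decide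
  · right; refine ⟨_, -theta8, 0, Pi.single 1 1, by simp; rfl, ?_, ?_⟩ <;> simp only [EE_expand] <;> decide
  · right; refine ⟨_, 0, 0, Pi.single 6 1, by simp; rfl, ?_, ?_⟩ <;> simp only [EE_expand] <;> decide

lemma GoodC_all (N : ℕ) : ∀ p : Fin 8 → ℤ, meas8 p + 62 < N → GoodC p := by
  induction N with
  | zero => intro p hp; have := meas8_bound p; push_cast at hp; omega
  | succ N ih =>
    intro p hp
    push_cast at hp
    by_cases h : ∀ i, 0 ≤ EE p (Pi.single i 1)
    · by_cases ht : EE p theta8 ≤ 3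
      · exact GoodC_terminal p h ht
      · apply GoodC_refl theta8 p theta_root
        apply GoodC_shift _ theta8
        apply ih
        rw [meas8_theta]; omega
    · push Not at h
      obtain ⟨i, hi⟩ := h
      apply GoodC_refl _ p (simple_root i)
      apply ih
      rw [meas8_refl]; omega

lemma GoodC_any (p : Fin 8 → ℤ) : GoodC p :=
  GoodC_all ((meas8 p + 62).toNat + 1) p (by have := meas8_bound p; push_cast; omega)

lemma bLM_apply (x y : LM) : bLM x y = x ⬝ᵥ (GLM *ᵥ y) := rfl

lemma bLM_expand (x y : LM) : bLM x y =
    (∑ i : Fin 4, (x (.inl (i, 0)) * y (.inl (i, 1)) + x (.inl (i, 1)) * y (.inl (i, 0))))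
    - ∑ j : Fin 2, EE (fun a => x (.inr (j, a))) (fun a => y (.inr (j, a))) := by
  rw [bLM_apply]
  simp only [dotProduct, Matrix.mulVec, Fintype.sum_sum_type, Fintype.sum_prod_type, EE_apply, GLM,
    Matrix.of_apply]
  simp [Fin.sum_univ_four, Fin.sum_univ_two]
  ring

lemma bLM_symm (x y : LM) : bLM x y = bLM y x := by
  rw [bLM_expand, bLM_expand]
  congr 1
  · exact Finset.sum_congr rfl fun i _ => by ring
  · exact Finset.sum_congr rfl fun i _ => EE_symm _ _

lemma EE_even (x : Fin 8 → ℤ) : Even (EE x x) := by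
  rw [EE_expand]
  refine ⟨x 0 ^ 2 + x 1 ^ 2 + x 2 ^ 2 + x 3 ^ 2 + x 4 ^ 2 + x 5 ^ 2 + x 6 ^ 2 + x 7 ^ 2
    - x 0 * x 2 - x 1 * x 3 - x 2 * x 3 - x 3 * x 4 - x 4 * x 5 - x 5 * x 6 - x 6 * x 7, by ring⟩

lemma bLM_even (x : LM) : Even (bLM x x) := by
  rw [bLM_expand]
  apply Even.sub
  · apply Finset.even_sum
    intro i _; exact ⟨x (.inl (i, 0)) * x (.inl (i, 1)), by ring⟩
  · apply Finset.even_sum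
    intro i _; exact EE_even _

def E8I : Matrix (Fin 8) (Fin 8) ℤ :=
  !![4,5,7,10,8,6,4,2;
     5,8,10,15,12,9,6,3;
     7,10,14,20,16,12,8,4;
     10,15,20,30,24,18,12,6;
     8,12,16,24,20,15,10,5;
     6,9,12,18,15,12,8,4;
     4,6,8,12,10,8,6,3;
     2,3,4,6,5,4,3,2]

lemma E8_inv : E8M * E8I = 1 := by decide +kernel

def GLMI : Matrix MukaiIx MukaiIx ℤ :=
  Matrix.of fun p q =>
    match p, q with
    | .inl (i, a), .inl (j, b) => if i = j ∧ a ≠ b then 1 else 0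
    | .inr (i, a), .inr (j, b) => if i = j then -(E8I a b) else 0
    | _, _ => 0

lemma GLM_inv : GLM * GLMI = 1 := by decide +kernel

instance : Fact (Nat.Prime 3) := ⟨by norm_num⟩

lemma lift_v (v : LM) (Φ : (Fin 8 ⊕ Fin 8 → ℤ) →ₗ[ℤ] LM)
    (hsat : ∀ x y, Φ x = (3 : ℤ) • y → ∃ x', x = (3 : ℤ) • x')
    (hperp : ∀ x, bLM (Φ x) v = 0)
    (hdiag : ∀ p x, (3 : ℤ) ∣ bLM (Φ x) (Φ (Sum.elim p p))) :
    ∃ p w, v = Φ (Sum.elim p p) + (3 : ℤ) • w := by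
  let f := Int.castRingHom (ZMod 3)
  set M := LinearMap.toMatrix' Φ with hM
  have hMΦ : ∀ x, M *ᵥ x = Φ x := fun x => by rw [hM, LinearMap.toMatrix'_mulVec]
  let Mb := M.map f
  let Gb := GLM.map f
  have hcast : ∀ x : Fin 8 ⊕ Fin 8 → ℤ, Mb *ᵥ (f ∘ x) = f ∘ (Φ x) := by
    intro x; rw [← hMΦ]; funext i; exact (RingHom.map_mulVec f M x i).symm
  have hlift : ∀ {ι : Type} (x : ι → ZMod 3), ∃ y : ι → ℤ, f ∘ y = x := by
    intro ι x
    exact ⟨fun i => ((x i).val : ℤ), by funext i; simp [f]⟩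
  have hz : ∀ {ι : Type} (x : ι → ℤ), f ∘ x = 0 → ∃ y : ι → ℤ, x = (3 : ℤ) • y := by
    intro ι x h
    have : ∀ i, ∃ y, x i = 3 * y := fun i => by
      have := congrFun h i
      exact (ZMod.intCast_zmod_eq_zero_iff_dvd (x i) 3).1 this
    choose y hy using this
    exact ⟨y, funext hy⟩
  have hMinj : Function.Injective Mb.mulVecLin := by
    rw [← LinearMap.ker_eq_bot, LinearMap.ker_eq_bot']
    intro xb hx
    obtain ⟨x, rfl⟩ := hlift xb
    rw [Matrix.mulVecLin_apply, hcast] at hx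
    obtain ⟨y, hy⟩ := hz _ hx
    obtain ⟨x', rfl⟩ := hsat _ _ hy
    funext i
    simp only [Function.comp, Pi.smul_apply, smul_eq_mul, map_mul, Pi.zero_apply]
    have : f 3 = 0 := by decide
    rw [this, zero_mul]
  have hrank : Mb.rank = 16 := by
    rw [Matrix.rank, LinearMap.finrank_range_of_inj hMinj]; simp
  have hGdet : IsUnit Gb.det := by
    have : Gb * GLMI.map f = 1 := by
      rw [← Matrix.map_mul, GLM_inv]; simp
    exact Matrix.isUnit_det_of_right_inverse this
  let A := Mbᵀ * Gb
  have hArank : A.rank = 16 := by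
    rw [Matrix.rank_mul_eq_left_of_isUnit_det _ _ hGdet, Matrix.rank_transpose, hrank]
  have hker : finrank (ZMod 3) (LinearMap.ker A.mulVecLin) = 8 := by
    have := LinearMap.finrank_range_add_finrank_ker A.mulVecLin
    have h2 : finrank (ZMod 3) (LinearMap.range A.mulVecLin) = 16 := hArank
    rw [h2] at this
    simp at this
    omega
  have hA : ∀ (y : LM) i, (A *ᵥ (f ∘ y)) i = f (bLM (Φ (Pi.single i 1)) y) := by
    intro y i
    have h1 : A = (Mᵀ * GLM).map f := by
      rw [Matrix.map_mul, Matrix.transpose_map]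
    rw [h1, ← RingHom.map_mulVec, ← Matrix.mulVec_mulVec, bLM_apply, ← hMΦ]
    congr 1
    rw [Matrix.mulVec_single_one]; rfl
  let dg : (Fin 8 → ZMod 3) →ₗ[ZMod 3] (Fin 8 ⊕ Fin 8 → ZMod 3) :=
    { toFun := fun p => Sum.elim p p
      map_add' := fun p q => by funext i; cases i <;> rfl
      map_smul' := fun p q => by funext i; cases i <;> rfl }
  let D := Mb.mulVecLin ∘ₗ dg
  have hDinj : Function.Injective D := by
    apply hMinj.comp
    intro p q h
    funext i
    exact congrFun h (Sum.inl i)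
  have hDc : ∀ p : Fin 8 → ℤ, D (f ∘ p) = f ∘ Φ (Sum.elim p p) := by
    intro p
    rw [← hcast]
    show Mb *ᵥ (Sum.elim (f ∘ p) (f ∘ p)) = _
    rw [Sum.comp_elim]
  have hle : LinearMap.range D ≤ LinearMap.ker A.mulVecLin := by
    rintro _ ⟨pb, rfl⟩
    obtain ⟨p, rfl⟩ := hlift pb
    rw [hDc, LinearMap.mem_ker, Matrix.mulVecLin_apply]
    funext i
    rw [hA]
    exact (ZMod.intCast_zmod_eq_zero_iff_dvd _ 3).2 (hdiag _ _)
  have heq : LinearMap.range D = LinearMap.ker A.mulVecLin := by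
    apply Submodule.eq_of_le_of_finrank_eq hle
    rw [hker, LinearMap.finrank_range_of_inj hDinj]; simp
  have hv : f ∘ v ∈ LinearMap.ker A.mulVecLin := by
    rw [LinearMap.mem_ker, Matrix.mulVecLin_apply]
    funext i
    rw [hA, hperp]; simp
  rw [← heq] at hv
  obtain ⟨pb, hp⟩ := hv
  obtain ⟨p, rfl⟩ := hlift pb
  rw [hDc] at hp
  obtain ⟨w, hw⟩ := hz (v - Φ (Sum.elim p p)) (by
    funext i
    have := congrFun hp i
    simp only [Function.comp] at this
    show f (v i - Φ (Sum.elim p p) i) = 0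
    rw [map_sub, this, sub_self])
  exact ⟨p, w, by rw [← hw]; abel⟩

def J0 : (Fin 8 ⊕ Fin 8 → ℤ) →ₗ[ℤ] E83 where
  toFun x := ![fun i => x (.inl i), fun i => x (.inr i), fun i => - x (.inl i) - x (.inr i)]
  map_add' x y := by
    funext j; fin_cases j <;> funext i <;> simp <;> ring
  map_smul' c y := by
    funext j; fin_cases j <;> funext i <;> simp <;> ring

lemma J0_mem (x : Fin 8 ⊕ Fin 8 → ℤ) : J0 x ∈ S3exo := by
  refine ⟨![fun i => x (.inl i), fun i => x (.inl i) + x (.inr i), 0], ?_⟩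
  funext j; fin_cases j <;> funext i <;> simp [J0, sigma3]
  ring

def JJ : (Fin 8 ⊕ Fin 8 → ℤ) →ₗ[ℤ] S3exo := J0.codRestrict S3exo J0_mem

lemma JJ_surj (s : S3exo) : ∃ x, s = JJ x := by
  obtain ⟨s, a, rfl⟩ := s
  refine ⟨Sum.elim (fun i => a 0 i - a 2 i) (fun i => a 1 i - a 0 i), ?_⟩
  apply Subtype.ext
  funext j; fin_cases j <;> funext i <;> simp [JJ, J0, sigma3]
  rfl

lemma JJ_inj (x y : Fin 8 ⊕ Fin 8 → ℤ) (h : JJ x = JJ y) : x = y := by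
  have h' : J0 x = J0 y := congrArg Subtype.val h
  funext i
  rcases i with i | i
  · exact congrFun (congrFun h' 0) i
  · exact congrFun (congrFun h' 1) i

lemma JJ_form (p q a b : Fin 8 → ℤ) : bE83 (JJ (Sum.elim p q) : E83) (JJ (Sum.elim a b) : E83) =
    -(EE p a + EE q b + EE (p + q) (a + b)) := by
  have h3 : EE (p + q) (a + b) = EE (-p - q) (-a - b) := by
    simp only [map_add, map_sub, map_neg, LinearMap.add_apply, LinearMap.sub_apply,
      LinearMap.neg_apply]; ring
  rw [h3, bE83, Fin.sum_univ_three]; rfl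

lemma prim_dvd (v : LM) (hv0 : v ≠ 0) (hvprim : ∀ (k : ℤ) (w : LM), v = k • w → IsUnit k)
    (k a : ℤ) (hk : k ≠ 0) (x : LM) (h : k • x = a • v) : k ∣ a := by
  obtain ⟨g, k', a', hg, hco, rfl, rfl⟩ : ∃ g k' a' : ℤ, g ≠ 0 ∧ IsCoprime k' a' ∧
      k = g * k' ∧ a = g * a' := by
    have hg : (Int.gcd k a : ℤ) ≠ 0 := by
      simp [Int.gcd_eq_zero_iff, hk]
    obtain ⟨k', hk'⟩ := Int.gcd_dvd_left k a
    obtain ⟨a', ha'⟩ := Int.gcd_dvd_right k a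
    refine ⟨Int.gcd k a, k', a', hg, ?_, hk', ha'⟩
    refine ⟨Int.gcdA k a, Int.gcdB k a, ?_⟩
    have := Int.gcd_eq_gcd_ab k a
    apply mul_left_cancel₀ hg
    linear_combination (-1 : ℤ) * this - Int.gcdA k a * hk' - Int.gcdB k a * ha'
  rw [mul_smul, mul_smul] at h
  have h2 := smul_right_injective LM hg h
  obtain ⟨u, z, huz⟩ := hco
  have : v = k' • (u • v + z • x) := by
    have e : v = (u * k' + z * a') • v := by rw [huz, one_smul]
    calc v = (u * k' + z * a') • v := e
      _ = k' • u • v + z • a' • v := by module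
      _ = _ := by rw [← h2]; module
  exact mul_dvd_mul_left g (hvprim _ _ this).dvd

/-- if `n ≡ 1 (mod 3)` and `S_{3.exo}` is primitively embedded in
`v^⊥ ⊆ L_M`, where `v` is primitive with `b(v,v) = 2n-2`, then some `t` in the image
of `S_{3.exo}` satisfies `(v+t)/3 ∈ L_M` and is a numerical wall divisor. -/
theorem stmt7 (n : ℕ) (hn : 2 ≤ n) (hmod : n % 3 = 1) (v : LM)
    (hvprim : ∀ (k : ℤ) (w : LM), v = k • w → IsUnit k)
    (hvsq : bLM v v = 2 * (n : ℤ) - 2)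
    (ι : ↥S3exo →ₗ[ℤ] LM)
    (hinj : Function.Injective ι)
    (hiso : ∀ s s' : ↥S3exo, bLM (ι s) (ι s') = bE83 (s : E83) (s' : E83))
    (hperp : ∀ s : ↥S3exo, bLM v (ι s) = 0)
    (hprim : ∀ (x : LM) (k : ℤ), bLM v x = 0 → k ≠ 0 →
      k • x ∈ LinearMap.range ι → x ∈ LinearMap.range ι) :
    ∃ s : ↥S3exo, (∃ w : LM, (3 : ℤ) • w = v + ι s) ∧ IsWallDivisor v (ι s) := by
  have hv0 : v ≠ 0 := by
    rintro rfl
    simp at hvsq; omega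
  set Φ : (Fin 8 ⊕ Fin 8 → ℤ) →ₗ[ℤ] LM := ι ∘ₗ JJ with hΦ
  have hΦa : ∀ x, Φ x = ι (JJ x) := fun x => rfl
  have hform : ∀ p q a b, bLM (Φ (Sum.elim p q)) (Φ (Sum.elim a b)) =
      -(EE p a + EE q b + EE (p + q) (a + b)) := by
    intro p q a b; rw [hΦa, hΦa, hiso, JJ_form]
  have hel : ∀ x : Fin 8 ⊕ Fin 8 → ℤ, ∃ p q, x = Sum.elim p q := fun x =>
    ⟨x ∘ Sum.inl, x ∘ Sum.inr, (Sum.elim_comp_inl_inr x).symm⟩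
  have hsat0 : ∀ (k : ℤ) x y, k ≠ 0 → Φ x = k • y → ∃ x', x = k • x' ∧ y = Φ x' := by
    intro k x y hk h
    have h1 : bLM v y = 0 := by
      have := hperp (JJ x)
      rw [← hΦa, h, map_smul, smul_eq_mul] at this
      exact (mul_eq_zero.1 this).resolve_left hk
    obtain ⟨s, hs⟩ := hprim y k h1 hk ⟨JJ x, h⟩
    obtain ⟨x', rfl⟩ := JJ_surj s
    refine ⟨x', ?_, hs.symm⟩
    apply JJ_inj
    apply hinj
    rw [map_smul, map_smul, hs]; exact h
  obtain ⟨p0, w0, hv⟩ := lift_v v Φ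
    (fun x y h => by obtain ⟨x', h', -⟩ := hsat0 3 x y (by norm_num) h; exact ⟨x', h'⟩)
    (fun x => by rw [bLM_symm]; exact hperp _)
    (fun p x => by
      obtain ⟨a, b, rfl⟩ := hel x
      rw [hform]
      refine ⟨-(EE a p + EE b p), ?_⟩
      simp only [map_add, LinearMap.add_apply]; ring)
  rcases GoodC_any (-p0) with ⟨u, hu⟩ | ⟨p, m, u, y, hp, hy, hN⟩
  · exfalso
    have : v = (3 : ℤ) • (w0 - Φ (Sum.elim u u)) := by
      rw [smul_sub, ← map_smul]
      have e : Sum.elim p0 p0 = - ((3 : ℤ) • Sum.elim u u) := by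
        have hu' : p0 = - ((3 : ℤ) • u) := by rw [← hu, neg_neg]
        rw [hu']; funext i; cases i <;> rfl
      rw [e, map_neg] at hv
      rw [hv]; abel
    have := hvprim _ _ this
    rw [Int.isUnit_iff] at this; omega
  set X : Fin 8 ⊕ Fin 8 → ℤ := Sum.elim p (p + (3 : ℤ) • m) with hX
  set N := EE p p + 3 * EE p m + 3 * EE m m with hNdef
  have htt : bLM (Φ X) (Φ X) = -6 * N := by
    rw [hX, hform]
    simp only [map_add, map_smul, LinearMap.add_apply, LinearMap.smul_apply, smul_eq_mul,
      EE_symm m p, hNdef]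
    ring
  have hvt : bLM v (Φ X) = 0 := hperp _
  obtain ⟨w, hw⟩ : ∃ w, (3 : ℤ) • w = v + Φ X := by
    refine ⟨w0 + Φ (Sum.elim u (u + m)), ?_⟩
    have e : X = (3 : ℤ) • Sum.elim u (u + m) - Sum.elim p0 p0 := by
      rw [hX, hp]; funext i; cases i <;> simp <;> ring
    rw [e, map_sub, map_smul, hv]; module
  have ht0 : Φ X ≠ 0 := by
    intro h
    rw [h] at htt
    simp at htt
    omega
  have hww9 : 9 * bLM w w = bLM v v - 6 * N := by
    have : bLM ((3 : ℤ) • w) ((3 : ℤ) • w) = bLM v v - 6 * N := by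
      rw [hw]
      simp only [map_add, LinearMap.add_apply, htt, hvt, bLM_symm (Φ X) v]
      ring
    simp only [map_smul, LinearMap.smul_apply, smul_eq_mul] at this
    linarith
  have hvw3 : 3 * bLM v w = bLM v v := by
    have : bLM v ((3 : ℤ) • w) = bLM v v := by
      rw [hw, map_add, hvt, add_zero]
    rwa [map_smul, smul_eq_mul] at this
  obtain ⟨k, hk1, hk⟩ : ∃ k : ℤ, 1 ≤ k ∧ bLM v v = 6 * k := ⟨((n : ℤ) - 1) / 3, by omega, by omega⟩
  have hvw : bLM v w = 2 * k := by omega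
  obtain ⟨e, he⟩ := bLM_even w
  have hek : 3 * e = k - N := by omega
  refine ⟨JJ X, ⟨w, hw⟩, hvt, ht0, ?_, Submodule.span ℤ {v, w}, w, ?_, ?_, ?_, ?_, rfl, ?_⟩
  · intro k' z hz hkz
    have hk0 : k' ≠ 0 := by
      rintro rfl; rw [zero_smul] at hkz; exact ht0 hkz
    obtain ⟨x', hx', -⟩ := hsat0 k' X z hk0 hkz
    obtain ⟨a, b, rfl⟩ := hel x'
    have hpa : p = k' • a := by
      funext i; exact congrFun hx' (Sum.inl i)
    rw [hpa, map_smul, LinearMap.smul_apply, smul_eq_mul] at hy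
    exact IsUnit.of_mul_eq_one _ hy
  · exact Submodule.subset_span (by simp)
  · have : ι (JJ X) = (3 : ℤ) • w - v := by rw [hw, ← hΦa]; abel
    rw [this]
    exact Submodule.sub_mem _ (Submodule.smul_mem _ _ (Submodule.subset_span (by simp)))
      (Submodule.subset_span (by simp))
  · have hli : LinearIndependent ℤ ![v, w] := by
      rw [LinearIndependent.pair_iff]
      intro s t hst
      have h1 : bLM v (s • v + t • w) = 0 := by rw [hst, map_zero]
      simp only [map_add, map_smul, smul_eq_mul, hvw, hk] at h1
      have h2 : 3 * s + t = 0 := by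
        have : (2 * k) * (3 * s + t) = 0 := by linarith
        exact (mul_eq_zero.1 this).resolve_left (by omega)
      have h3 : t • Φ X = 0 := by
        have : t • Φ X = (3 : ℤ) • (s • v + t • w) - (3 * s + t) • v := by
          have e : Φ X = (3 : ℤ) • w - v := by rw [hw]; abel
          rw [e]; module
        rw [this, hst, h2]; simp
      have h4 : t = 0 := (smul_eq_zero.1 h3).resolve_right ht0
      exact ⟨by omega, h4⟩
    have := finrank_span_eq_card hli
    rwa [Matrix.range_cons_cons_empty, Fintype.card_fin] at this
  · intro x k' hk' hx
    rw [Submodule.mem_span_pair] at hx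
    obtain ⟨α, β, hx⟩ := hx
    have h1 : (3 * k') • x = (3 * α + β) • v + β • Φ X := by
      have e : Φ X = (3 : ℤ) • w - v := by rw [hw]; abel
      rw [e, mul_smul, ← hx]; module
    have hb : k' ∣ β := by
      have h2 := congrArg (fun z => bLM z (Φ (Sum.elim ((2 : ℤ) • y) (-y)))) h1
      simp only [map_add, map_smul, LinearMap.add_apply, LinearMap.smul_apply, smul_eq_mul] at h2
      rw [hX, hform, show bLM v (Φ (Sum.elim ((2 : ℤ) • y) (-y))) = 0 from hperp _] at h2
      simp only [map_add, map_smul, map_neg, LinearMap.add_apply, LinearMap.smul_apply,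
        smul_eq_mul, hy] at h2
      refine ⟨-bLM x (Φ (Sum.elim ((2 : ℤ) • y) (-y))), ?_⟩
      linarith
    obtain ⟨β', rfl⟩ := hb
    have h3 : k' • (x - β' • w) = α • v := by
      rw [smul_sub, ← hx]; module
    obtain ⟨α', rfl⟩ := prim_dvd v hv0 hvprim k' α hk' _ h3
    rw [mul_smul] at h3
    have h4 := smul_right_injective LM hk' h3
    rw [Submodule.mem_span_pair]
    exact ⟨α', β', by rw [← h4]; abel⟩
  · rw [hvw, hk, he]
    by_cases he1 : e = -1
    · left; omega
    · right
      have he0 : 0 ≤ e := by omega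
      have hke : 3 * e ≤ k := by omega
      refine ⟨by positivity, by nlinarith, by nlinarith⟩
end
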